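/- arXiv:1210.0124 — 4 statements merged into one kernel-verified Lean document; each statement's English description precedes it below -/
import Mathlib

section
/- Let n ≥ 2, let Π ⊂ ℝⁿ be a box, and let f and g be checkered functions on Π. Suppose u, w : closure(Π) → ℝ are continuously differentiable on closure(Π) and satisfy Δu = f and Δw = g in the distributional sense on the interior of Π (i.e. ∫ u·Δφ dx = ∫ f·φ dx for every smooth compactly supported φ on the interior of Π, and likewise for w and g). If u(x) = w(x) for every x ∈ ∂Π, and ⟨∇u(x), ν⟩ = ⟨∇w(x), ν⟩ for every x in the relative interior of each (n−1)-dimensional face of Π, where ν is the outward unit normal to that face, then f = g almost everywhere on Π. -/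
open MeasureTheory

noncomputable section

/-- The half-open box `[a₁,b₁) × ⋯ × [aₙ,bₙ)` in `ℝⁿ`. -/
def box {n : ℕ} (a b : Fin n → ℝ) : Set (Fin n → ℝ) :=
  Set.univ.pi fun i => Set.Ico (a i) (b i)

/-- A function is checkered on `P` if it is a finite linear combination of
characteristic functions of boxes contained in `P`. -/
def Checkered {n : ℕ} (P : Set (Fin n → ℝ)) (f : (Fin n → ℝ) → ℝ) : Prop :=
  ∃ (N : ℕ) (c : Fin N → ℝ) (lo hi : Fin N → Fin n → ℝ),
    (∀ k i, lo k i < hi k i) ∧ (∀ k, box (lo k) (hi k) ⊆ P) ∧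
    f = fun x => ∑ k, c k * Set.indicator (box (lo k) (hi k)) (fun _ => (1:ℝ)) x

/-- The Laplacian `Δu(x) = ∑ᵢ ∂²u/∂xᵢ²(x)`. -/
def lap {n : ℕ} (u : (Fin n → ℝ) → ℝ) (x : Fin n → ℝ) : ℝ :=
  ∑ i, fderiv ℝ (fun y => fderiv ℝ u y (Pi.single i 1)) x (Pi.single i 1)


open Function

lemma closure_box {n : ℕ} {a b : Fin n → ℝ} (hab : ∀ i, a i < b i) :
    closure (box a b) = Set.Icc a b := by
  rw [box, closure_pi_set, ← Set.pi_univ_Icc]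
  simp only [closure_Ico (hab _).ne]

lemma interior_box {n : ℕ} (a b : Fin n → ℝ) :
    interior (box a b) = Set.univ.pi fun i => Set.Ioo (a i) (b i) := by
  rw [box, interior_pi_set Set.finite_univ]
  simp only [interior_Ico]

lemma measurableSet_box {n : ℕ} (a b : Fin n → ℝ) : MeasurableSet (box a b) :=
  MeasurableSet.univ_pi fun _ => measurableSet_Ico

/-- Directional derivatives of a function with separated variables. -/
lemma fderiv_clm_prod {n : ℕ} (ℓ : ℂ →L[ℝ] ℝ) {ψ : Fin n → ℝ → ℂ}
    (hψ : ∀ j, Differentiable ℝ (ψ j)) (y : Fin n → ℝ) (i : Fin n) :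
    fderiv ℝ (fun x : Fin n → ℝ => ℓ (∏ j, ψ j (x j))) y (Pi.single i 1)
      = ℓ (∏ j, update ψ i (deriv (ψ i)) j (y j)) := by
  have h1 : ∀ j ∈ Finset.univ, HasFDerivAt (fun x : Fin n → ℝ => ψ j (x j))
      ((ContinuousLinearMap.proj (R := ℝ) (φ := fun _ : Fin n => ℝ) j).smulRight
        (deriv (ψ j) (y j))) y := by
    intro j _
    have h2 : HasFDerivAt (fun x : Fin n → ℝ => x j)
      (ContinuousLinearMap.proj (R := ℝ) (φ := fun _ : Fin n => ℝ) j) y :=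
      hasFDerivAt_apply j y
    have h3 := ((hψ j) (y j)).hasDerivAt.hasFDerivAt.comp y h2
    convert! h3 using 1
  have h4 := ℓ.hasFDerivAt.comp y (HasFDerivAt.finsetProd (u := Finset.univ) h1)
  have h5 : fderiv ℝ (fun x : Fin n → ℝ => ℓ (∏ j, ψ j (x j))) y = _ := h4.fderiv
  rw [h5]
  simp only [ContinuousLinearMap.comp_apply, _root_.sum_apply,
    _root_.smul_apply, ContinuousLinearMap.smulRight_apply,
    ContinuousLinearMap.proj_apply]
  congr 1
  rw [Finset.sum_eq_single i]
  · rw [← Finset.mul_prod_erase _ _ (Finset.mem_univ i)]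
    simp only [Pi.single_eq_same, one_smul, smul_eq_mul, update_self]
    rw [mul_comm]
    congr 1
    refine Finset.prod_congr rfl fun j hj => ?_
    rw [update_of_ne (Finset.ne_of_mem_erase hj)]
  · intro j _ hj
    simp [Pi.single_eq_of_ne hj]
  · simp

/-- The Laplacian of a function with separated variables. -/
lemma lap_clm_prod {n : ℕ} (ℓ : ℂ →L[ℝ] ℝ) {ψ : Fin n → ℝ → ℂ}
    (hψ : ∀ j, ContDiff ℝ (⊤ : ℕ∞) (ψ j)) (y : Fin n → ℝ) :
    lap (fun x : Fin n → ℝ => ℓ (∏ j, ψ j (x j))) y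
      = ∑ i, ℓ (deriv (deriv (ψ i)) (y i) * ∏ j ∈ Finset.univ.erase i, ψ j (y j)) := by
  have hd : ∀ j, Differentiable ℝ (ψ j) := fun j => (hψ j).differentiable (by simp)
  have hd' : ∀ j, Differentiable ℝ (deriv (ψ j)) := fun j =>
    ((contDiff_infty_iff_deriv.1 (hψ j)).2).differentiable (by simp)
  refine Finset.sum_congr rfl fun i _ => ?_
  simp only [fderiv_clm_prod ℓ hd]
  rw [fderiv_clm_prod ℓ (ψ := update ψ i (deriv (ψ i)))]
  · rw [← Finset.mul_prod_erase _ _ (Finset.mem_univ i)]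
    simp only [update_self, update_idem]
    congr 2
    refine Finset.prod_congr rfl fun j hj => ?_
    rw [update_of_ne (Finset.ne_of_mem_erase hj)]
  · intro j
    by_cases h : j = i
    · subst h
      simpa using hd' j
    · simpa [update_of_ne h] using hd j

lemma exists_bound_deriv_smoothTransition :
    ∃ K : ℝ, 0 ≤ K ∧ (∀ x, |deriv Real.smoothTransition x| ≤ K) ∧
      ∀ x, |deriv (deriv Real.smoothTransition) x| ≤ K := by
  have h0 : ContDiff ℝ (⊤ : ℕ∞) Real.smoothTransition := Real.smoothTransition.contDiff
  have h1 := (contDiff_infty_iff_deriv.1 h0).2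
  have h2 := (contDiff_infty_iff_deriv.1 h1).2
  have hz : ∀ x, x ∉ Set.Icc (0:ℝ) 1 → ∃ c : ℝ, Real.smoothTransition =ᶠ[nhds x] fun _ => c := by
    intro x hx
    by_cases h : x < 0
    · exact ⟨0, Filter.eventuallyEq_of_mem (Iio_mem_nhds h)
        fun y hy => Real.smoothTransition.zero_of_nonpos (le_of_lt hy)⟩
    · have h' : 1 < x := by
        by_contra h'
        exact hx ⟨not_lt.1 h, not_lt.1 h'⟩
      exact ⟨1, Filter.eventuallyEq_of_mem (Ioi_mem_nhds h')
        fun y hy => Real.smoothTransition.one_of_one_le (le_of_lt hy)⟩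
  obtain ⟨K₁, hK₁⟩ := (isCompact_Icc (a := (0:ℝ)) (b := 1)).exists_bound_of_continuousOn
    h1.continuous.continuousOn
  obtain ⟨K₂, hK₂⟩ := (isCompact_Icc (a := (0:ℝ)) (b := 1)).exists_bound_of_continuousOn
    h2.continuous.continuousOn
  have hK : 0 ≤ max (max K₁ K₂) 0 := le_max_right _ _
  refine ⟨max (max K₁ K₂) 0, hK, fun x => ?_, fun x => ?_⟩
  · by_cases hx : x ∈ Set.Icc (0:ℝ) 1
    · exact (hK₁ x hx).trans ((le_max_left _ _).trans (le_max_left _ _))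
    · obtain ⟨c, hc⟩ := hz x hx
      rw [hc.deriv_eq]
      simp [hK]
  · by_cases hx : x ∈ Set.Icc (0:ℝ) 1
    · exact (hK₂ x hx).trans ((le_max_right _ _).trans (le_max_left _ _))
    · obtain ⟨c, hc⟩ := hz x hx
      rw [hc.deriv.deriv_eq]
      simp [hK]

/-- Smooth cutoff functions of an interval, with control of the first two derivatives. -/
lemma exists_cutoff (a b : ℝ) :
    ∃ K : ℝ, 0 ≤ K ∧ ∀ ε : ℝ, 0 < ε → ∃ χ χ' χ'' : ℝ → ℝ, ContDiff ℝ (⊤ : ℕ∞) χ ∧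
      (∀ s, HasDerivAt χ (χ' s) s) ∧ (∀ s, HasDerivAt χ' (χ'' s) s) ∧
      (∀ s, s ∉ Set.Icc (a + ε) (b - ε) → χ s = 0) ∧
      (∀ s ∈ Set.Icc (a + 2 * ε) (b - 2 * ε), χ s = 1) ∧
      ∀ s, |χ s| ≤ 1 ∧ |χ' s| ≤ K / ε ∧ |χ'' s| ≤ K / ε ^ 2 := by
  obtain ⟨K, hK, hK₁, hK₂⟩ := exists_bound_deriv_smoothTransition
  set ρ := Real.smoothTransition with hρ
  have h0 : ContDiff ℝ (⊤ : ℕ∞) ρ := Real.smoothTransition.contDiff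
  have h1 := (contDiff_infty_iff_deriv.1 h0)
  have h2 := (contDiff_infty_iff_deriv.1 h1.2)
  have hρ1 : ∀ x, |ρ x| ≤ 1 := fun x => by
    rw [abs_of_nonneg (Real.smoothTransition.nonneg x)]
    exact Real.smoothTransition.le_one x
  refine ⟨2 * K + 2 * K ^ 2, by positivity, fun ε hε => ?_⟩
  have hl : ∀ s, HasDerivAt (fun s => (s - a) / ε - 1) (1 / ε) s := fun s =>
    (((hasDerivAt_id s).sub_const a).div_const ε).sub_const 1
  have hr : ∀ s, HasDerivAt (fun s => (b - s) / ε - 1) (-1 / ε) s := fun s =>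
    (((hasDerivAt_id s).const_sub b).div_const ε).sub_const 1
  have hd : ∀ x, HasDerivAt ρ (deriv ρ x) x := fun x => (h1.1 x).hasDerivAt
  have hd' : ∀ x, HasDerivAt (deriv ρ) (deriv (deriv ρ) x) x := fun x => (h2.1 x).hasDerivAt
  set L : ℝ → ℝ := fun s => (s - a) / ε - 1
  set R : ℝ → ℝ := fun s => (b - s) / ε - 1
  refine ⟨fun s => ρ (L s) * ρ (R s),
    fun s => deriv ρ (L s) * (1 / ε) * ρ (R s) + ρ (L s) * (deriv ρ (R s) * (-1 / ε)),
    fun s => (deriv (deriv ρ) (L s) * (1 / ε) * (1 / ε) * ρ (R s)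
        + deriv ρ (L s) * (1 / ε) * (deriv ρ (R s) * (-1 / ε)))
      + (deriv ρ (L s) * (1 / ε) * (deriv ρ (R s) * (-1 / ε))
        + ρ (L s) * (deriv (deriv ρ) (R s) * (-1 / ε) * (-1 / ε))), ?_, ?_, ?_, ?_, ?_, ?_⟩
  · have hL : ContDiff ℝ (⊤ : ℕ∞) L := by fun_prop
    have hR : ContDiff ℝ (⊤ : ℕ∞) R := by fun_prop
    exact (h0.comp hL).mul (h0.comp hR)
  · intro s
    exact ((hd _).comp s (hl s)).mul ((hd _).comp s (hr s))
  · intro s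
    exact ((((hd' _).comp s (hl s)).mul_const _).mul ((hd _).comp s (hr s))).add
      (((hd _).comp s (hl s)).mul (((hd' _).comp s (hr s)).mul_const _))
  · intro s hs
    by_cases h : a + ε ≤ s
    · have h' : b - ε < s := by
        by_contra h'
        exact hs ⟨h, not_lt.1 h'⟩
      have : ρ (R s) = 0 := Real.smoothTransition.zero_of_nonpos (by
        have : (b - s) / ε ≤ 1 := (div_le_one hε).2 (by linarith)
        simp only [R]; linarith)
      simp [this]
    · have : ρ (L s) = 0 := Real.smoothTransition.zero_of_nonpos (by
        have : (s - a) / ε ≤ 1 := (div_le_one hε).2 (by linarith)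
        simp only [L]; linarith)
      simp [this]
  · intro s hs
    have e1 : ρ (L s) = 1 := Real.smoothTransition.one_of_one_le (by
        have : 2 ≤ (s - a) / ε := (le_div_iff₀ hε).2 (by linarith [hs.1])
        simp only [L]; linarith)
    have e2 : ρ (R s) = 1 := Real.smoothTransition.one_of_one_le (by
        have : 2 ≤ (b - s) / ε := (le_div_iff₀ hε).2 (by linarith [hs.2])
        simp only [R]; linarith)
    simp [e1, e2]
  · intro s
    have hε' : |1 / ε| = 1 / ε := abs_of_pos (by positivity)
    have hε'' : |-1 / ε| = 1 / ε := by rw [neg_div, abs_neg, hε']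
    have hεp : 0 < 1 / ε := by positivity
    have bl := hρ1 (L s)
    have br := hρ1 (R s)
    have bl1 := hK₁ (L s)
    have br1 := hK₁ (R s)
    have bl2 := hK₂ (L s)
    have br2 := hK₂ (R s)
    refine ⟨?_, ?_, ?_⟩
    · simp only [abs_mul]
      exact mul_le_one₀ bl (abs_nonneg _) br
    · have t1 : |deriv ρ (L s) * (1 / ε) * ρ (R s)| ≤ K * (1 / ε) * 1 := by
        simp only [abs_mul, hε']; gcongr
      have t2 : |ρ (L s) * (deriv ρ (R s) * (-1 / ε))| ≤ 1 * (K * (1 / ε)) := by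
        simp only [abs_mul, hε'']; gcongr
      refine (abs_add_le _ _).trans ((add_le_add t1 t2).trans ?_)
      have : (2 * K + 2 * K ^ 2) / ε = K * (1 / ε) * 1 + 1 * (K * (1 / ε)) + 2 * K ^ 2 / ε := by
        ring
      rw [this]
      have : 0 ≤ 2 * K ^ 2 / ε := by positivity
      linarith
    · have t1 : |deriv (deriv ρ) (L s) * (1 / ε) * (1 / ε) * ρ (R s)|
          ≤ K * (1 / ε) * (1 / ε) * 1 := by
        simp only [abs_mul, hε']; gcongr
      have t2 : |deriv ρ (L s) * (1 / ε) * (deriv ρ (R s) * (-1 / ε))|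
          ≤ K * (1 / ε) * (K * (1 / ε)) := by
        simp only [abs_mul, hε', hε'']; gcongr
      have t3 : |ρ (L s) * (deriv (deriv ρ) (R s) * (-1 / ε) * (-1 / ε))|
          ≤ 1 * (K * (1 / ε) * (1 / ε)) := by
        simp only [abs_mul, hε'']; gcongr
      refine (abs_add_le _ _).trans ((add_le_add ((abs_add_le _ _).trans (add_le_add t1 t2))
        ((abs_add_le _ _).trans (add_le_add t2 t3))).trans (le_of_eq ?_))
      field_simp
      ring

/-- Truncations of an exponential function to an interval. -/
lemma exists_truncated_exp (a b : ℝ) (ζ : ℂ) :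
    ∃ K : ℝ, 1 ≤ K ∧ ∀ ε : ℝ, 0 < ε → ε ≤ 1 → ∃ ψ : ℝ → ℂ, ContDiff ℝ (⊤ : ℕ∞) ψ ∧
      (∀ s, s ∉ Set.Icc (a + ε) (b - ε) → ψ s = 0) ∧
      (∀ s ∈ Set.Icc (a + 2 * ε) (b - 2 * ε), ψ s = Complex.exp (ζ * s)) ∧
      (∀ s, s ∉ Set.Icc (a + ε) (b - ε) → deriv (deriv ψ) s - ζ ^ 2 * ψ s = 0) ∧
      (∀ s ∈ Set.Ioo (a + 2 * ε) (b - 2 * ε), deriv (deriv ψ) s - ζ ^ 2 * ψ s = 0) ∧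
      ∀ s ∈ Set.Icc a b, ‖Complex.exp (ζ * s)‖ ≤ K ∧ ‖ψ s‖ ≤ K ∧
        ‖deriv (deriv ψ) s - ζ ^ 2 * ψ s‖ ≤ K / ε ^ 2 := by
  obtain ⟨K, hK, hχ⟩ := exists_cutoff a b
  have hE : ContDiff ℝ (⊤ : ℕ∞) fun s : ℝ => Complex.exp (ζ * s) :=
    (contDiff_const.mul Complex.ofRealCLM.contDiff).cexp
  have hE' : ∀ s : ℝ, HasDerivAt (fun s : ℝ => Complex.exp (ζ * s))
      (ζ * Complex.exp (ζ * s)) s := fun s => by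
    have := (((hasDerivAt_id s).ofReal_comp).const_mul ζ).cexp
    simpa [mul_comm] using this
  obtain ⟨M, hM⟩ := (isCompact_Icc (a := a) (b := b)).exists_bound_of_continuousOn
    hE.continuous.continuousOn
  set M' := max M 1
  have hM1 : 1 ≤ M' := le_max_right _ _
  refine ⟨M' * (1 + K + 2 * ‖ζ‖ * K), ?_, fun ε hε hε1 => ?_⟩
  · have : 1 ≤ 1 + K + 2 * ‖ζ‖ * K := by
      have : 0 ≤ 2 * ‖ζ‖ * K := by positivity
      linarith
    exact one_le_mul_of_one_le_of_one_le hM1 this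
  obtain ⟨χ, χ', χ'', hχs, hχ1, hχ2, hχ0, hχe, hχb⟩ := hχ ε hε
  have d1 : ∀ s, HasDerivAt (fun s : ℝ => (χ s : ℂ) * Complex.exp (ζ * s))
      ((χ' s : ℂ) * Complex.exp (ζ * s) + χ s * (ζ * Complex.exp (ζ * s))) s := fun s =>
    (hχ1 s).ofReal_comp.mul (hE' s)
  have d2 : ∀ s, HasDerivAt
      (fun s : ℝ => (χ' s : ℂ) * Complex.exp (ζ * s) + χ s * (ζ * Complex.exp (ζ * s)))
      (((χ'' s : ℂ) * Complex.exp (ζ * s) + χ' s * (ζ * Complex.exp (ζ * s)))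
        + ((χ' s : ℂ) * (ζ * Complex.exp (ζ * s))
          + χ s * (ζ * (ζ * Complex.exp (ζ * s))))) s := fun s =>
    ((hχ2 s).ofReal_comp.mul (hE' s)).add ((hχ1 s).ofReal_comp.mul ((hE' s).const_mul ζ))
  have e1 : deriv (fun s : ℝ => (χ s : ℂ) * Complex.exp (ζ * s)) = _ :=
    funext fun s => (d1 s).deriv
  have e2 : ∀ s, deriv (deriv (fun s : ℝ => (χ s : ℂ) * Complex.exp (ζ * s))) s
      - ζ ^ 2 * ((χ s : ℂ) * Complex.exp (ζ * s))
      = (χ'' s + 2 * ζ * χ' s) * Complex.exp (ζ * s) := fun s => by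
    rw [e1, (d2 s).deriv]
    ring
  have locconst : ∀ (s : ℝ) (c : ℝ), χ =ᶠ[nhds s] (fun _ => c) → χ' s = 0 ∧ χ'' s = 0 := by
    intro s c hc
    have h1 : χ' =ᶠ[nhds s] fun _ => 0 := by
      have := hc.deriv
      rw [show deriv χ = χ' from funext fun s => (hχ1 s).deriv] at this
      simpa using this
    refine ⟨h1.eq_of_nhds, ?_⟩
    rw [← (hχ2 s).deriv, h1.deriv_eq]
    simp
  refine ⟨fun s => (χ s : ℂ) * Complex.exp (ζ * s), ?_, ?_, ?_, ?_, ?_, ?_⟩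
  · exact (Complex.ofRealCLM.contDiff.comp hχs).mul hE
  · intro s hs
    simp [hχ0 s hs]
  · intro s hs
    simp [hχe s hs]
  · intro s hs
    obtain ⟨h1, h2⟩ := locconst s 0 (Filter.eventuallyEq_of_mem
      (isClosed_Icc.isOpen_compl.mem_nhds hs) fun y hy => hχ0 y hy)
    simp [e2, h1, h2]
  · intro s hs
    obtain ⟨h1, h2⟩ := locconst s 1 (Filter.eventuallyEq_of_mem
      (isOpen_Ioo.mem_nhds hs) fun y hy => hχe y (Set.Ioo_subset_Icc_self hy))
    simp [e2, h1, h2]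
  · intro s hs
    have hMs : ‖Complex.exp (ζ * s)‖ ≤ M' := (hM s hs).trans (le_max_left _ _)
    obtain ⟨b0, b1, b2⟩ := hχb s
    have hbig : M' ≤ M' * (1 + K + 2 * ‖ζ‖ * K) := by
      refine le_mul_of_one_le_right (by linarith) ?_
      have : 0 ≤ 2 * ‖ζ‖ * K := by positivity
      linarith
    refine ⟨hMs.trans hbig, ?_, ?_⟩
    · rw [norm_mul, Complex.norm_real, Real.norm_eq_abs]
      calc |χ s| * ‖Complex.exp (ζ * s)‖ ≤ 1 * M' := by gcongr
        _ ≤ _ := by linarith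
    · rw [e2, norm_mul]
      have hb1 : |χ' s| ≤ K / ε ^ 2 := by
        refine b1.trans ?_
        gcongr
        nlinarith
      calc ‖(χ'' s : ℂ) + 2 * ζ * χ' s‖ * ‖Complex.exp (ζ * s)‖
          ≤ (K / ε ^ 2 + 2 * ‖ζ‖ * (K / ε ^ 2)) * M' := by
            refine mul_le_mul ?_ hMs (norm_nonneg _) (by positivity)
            refine (norm_add_le _ _).trans ?_
            simp only [norm_mul, Complex.norm_real, Real.norm_eq_abs, Complex.norm_two]
            gcongr
        _ ≤ _ := by
            rw [show M' * (1 + K + 2 * ‖ζ‖ * K) / ε ^ 2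
              = (K / ε ^ 2 + 2 * ‖ζ‖ * (K / ε ^ 2)) * M' + M' / ε ^ 2 by ring]
            have : 0 ≤ M' / ε ^ 2 := by positivity
            linarith

lemma uniqueDiffOn_Icc_pi {n : ℕ} {a b : Fin n → ℝ} (hab : ∀ i, a i < b i) :
    UniqueDiffOn ℝ (Set.Icc a b) := by
  refine uniqueDiffOn_convex (convex_Icc a b) ?_
  rw [← closure_box hab]
  refine Set.Nonempty.mono (interior_mono subset_closure) ?_
  rw [interior_box]
  exact Set.univ_pi_nonempty_iff.2 fun i => Set.nonempty_Ioo.2 (hab i)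

/-- A `C¹` function on a closed box whose Cauchy data vanish on the boundary is `o(dist)` near
each face. -/
lemma exists_abs_le_of_flat_boundary {n : ℕ} {a b : Fin n → ℝ} (hab : ∀ i, a i < b i)
    {v : (Fin n → ℝ) → ℝ} (hv : ContDiffOn ℝ 1 v (Set.Icc a b))
    (h0 : ∀ x ∈ Set.Icc a b, ∀ i, (x i = a i ∨ x i = b i) → v x = 0)
    (h1 : ∀ i, ∀ x ∈ Set.Icc a b, (∀ j, j ≠ i → x j ∈ Set.Ioo (a j) (b j)) →
      (x i = a i ∨ x i = b i) → fderivWithin ℝ v (Set.Icc a b) x (Pi.single i 1) = 0)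
    {η : ℝ} (hη : 0 < η) :
    ∃ δ > 0, ∀ x : Fin n → ℝ, (∀ j, x j ∈ Set.Ioo (a j) (b j)) → ∀ i c, (c = a i ∨ c = b i) →
      |x i - c| ≤ δ → |v x| ≤ η * |x i - c| := by
  have hc := isCompact_Icc.uniformContinuousOn_of_continuous
    (hv.continuousOn_fderivWithin (uniqueDiffOn_Icc_pi hab) le_rfl)
  obtain ⟨δ, hδ, hD⟩ := Metric.uniformContinuousOn_iff_le.1 hc η hη
  refine ⟨δ, hδ, fun x hx i c hci hxc => ?_⟩
  have hcI : c ∈ Set.Icc (a i) (b i) := by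
    rcases hci with rfl | rfl
    · exact ⟨le_rfl, (hab i).le⟩
    · exact ⟨(hab i).le, le_rfl⟩
  have hmem : ∀ s ∈ Set.uIcc c (x i), update x i s ∈ Set.Icc a b := by
    intro s hs
    have hs' : s ∈ Set.Icc (a i) (b i) :=
      Set.uIcc_subset_Icc hcI (Set.Ioo_subset_Icc_self (hx i)) hs
    rw [← Set.pi_univ_Icc]
    intro j _
    by_cases hj : j = i
    · subst hj
      simpa using hs'
    · rw [update_of_ne hj]
      exact Set.Ioo_subset_Icc_self (hx j)
  have hcm : update x i c ∈ Set.Icc a b := hmem c Set.left_mem_uIcc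
  have hz : fderivWithin ℝ v (Set.Icc a b) (update x i c) (Pi.single i 1) = 0 :=
    h1 i _ hcm (fun j hj => by rw [update_of_ne hj]; exact hx j) (by simpa using hci)
  have key := Convex.norm_image_sub_le_of_norm_hasDerivWithin_le
    (f := fun s => v (update x i s)) (s := Set.uIcc c (x i)) (C := η)
    (f' := fun s => fderivWithin ℝ v (Set.Icc a b) (update x i s) (Pi.single i 1))
    (x := c) (y := x i) ?_ ?_ (convex_uIcc _ _) Set.left_mem_uIcc Set.right_mem_uIcc
  · simpa [h0 _ hcm i (by simpa using hci)] using key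
  · intro s hs
    exact ((hv.differentiableOn one_ne_zero _ (hmem s hs)).hasFDerivWithinAt).comp_hasDerivWithinAt
      s (hasDerivAt_update x i s).hasDerivWithinAt hmem
  · intro s hs
    have hd : dist (update x i s) (update x i c) ≤ δ := by
      refine (dist_pi_le_iff hδ.le).2 fun j => ?_
      by_cases hj : j = i
      · subst hj
        simp only [update_self, Real.dist_eq]
        exact (Set.abs_sub_left_of_mem_uIcc hs).trans hxc
      · simp [update_of_ne hj, hδ.le]
    have := hD _ (hmem s hs) _ hcm hd
    rw [dist_eq_norm] at this
    calc ‖fderivWithin ℝ v (Set.Icc a b) (update x i s) (Pi.single i 1)‖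
        = ‖(fderivWithin ℝ v (Set.Icc a b) (update x i s)
            - fderivWithin ℝ v (Set.Icc a b) (update x i c)) (Pi.single i 1)‖ := by
          rw [_root_.sub_apply, hz, sub_zero]
      _ ≤ η * ‖(Pi.single i 1 : Fin n → ℝ)‖ := ContinuousLinearMap.le_of_opNorm_le _ this _
      _ = η := by rw [Pi.norm_single, norm_one, mul_one]

/-- Integrals of functions supported in a thin layer around the boundary of a box. -/
lemma exists_layer_integral_bound {n : ℕ} {a b : Fin n → ℝ} (hab : ∀ i, a i < b i) :
    ∃ K : ℝ, 0 ≤ K ∧ ∀ ε > 0, ∀ (G : (Fin n → ℝ) → ℝ) (M : ℝ), 0 ≤ M →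
      (∀ x ∈ box a b, |G x| ≤ M) →
      (∀ x ∈ box a b, (∀ i, x i ∈ Set.Ioo (a i + 2 * ε) (b i - 2 * ε)) → G x = 0) →
      |∫ x in box a b, G x| ≤ M * (K * ε) := by
  refine ⟨∑ i, 4 * ∏ j ∈ Finset.univ \ {i}, (b j - a j),
    Finset.sum_nonneg fun i _ => mul_nonneg (by norm_num)
      (Finset.prod_nonneg fun j _ => (sub_pos.2 (hab j)).le), fun ε hε G M hM hG hG0 => ?_⟩
  set S₁ : Fin n → Set (Fin n → ℝ) := fun i => Set.Icc a (update b i (a i + 2 * ε))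
  set S₂ : Fin n → Set (Fin n → ℝ) := fun i => Set.Icc (update a i (b i - 2 * ε)) b
  have hS₁ : ∀ i, volume.real (S₁ i) = 2 * ε * ∏ j ∈ Finset.univ \ {i}, (b j - a j) := by
    intro i
    have hle : a ≤ update b i (a i + 2 * ε) := by
      intro j
      by_cases hj : j = i
      · subst hj; simp [hε.le]
      · simpa [update_of_ne hj] using (hab j).le
    rw [measureReal_def, Real.volume_Icc_pi_toReal hle]
    have : ∀ j, update b i (a i + 2 * ε) j - a j = update (fun j => b j - a j) i (2 * ε) j := by
      intro j
      by_cases hj : j = i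
      · subst hj; simp
      · simp [update_of_ne hj]
    simp only [this]
    exact Finset.prod_update_of_mem (Finset.mem_univ i) _ _
  have hS₂ : ∀ i, volume.real (S₂ i) = 2 * ε * ∏ j ∈ Finset.univ \ {i}, (b j - a j) := by
    intro i
    have hle : update a i (b i - 2 * ε) ≤ b := by
      intro j
      by_cases hj : j = i
      · subst hj; simp [hε.le]
      · simpa [update_of_ne hj] using (hab j).le
    rw [measureReal_def, Real.volume_Icc_pi_toReal hle]
    have : ∀ j, b j - update a i (b i - 2 * ε) j = update (fun j => b j - a j) i (2 * ε) j := by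
      intro j
      by_cases hj : j = i
      · subst hj; simp
      · simp [update_of_ne hj]
    simp only [this]
    exact Finset.prod_update_of_mem (Finset.mem_univ i) _ _
  set S : Set (Fin n → ℝ) := ⋃ i, (S₁ i ∪ S₂ i)
  have hScomp : IsCompact S := isCompact_iUnion fun i => isCompact_Icc.union isCompact_Icc
  have hSfin : volume S < ⊤ := hScomp.measure_lt_top
  have hout : ∀ x ∈ box a b \ (box a b ∩ S), G x = 0 := by
    rintro x ⟨hx, hxS⟩
    refine hG0 x hx fun i => ?_
    have hxi : ∀ j, a j ≤ x j ∧ x j < b j := fun j => hx j (Set.mem_univ j)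
    constructor
    · by_contra hc
      refine hxS ⟨hx, Set.mem_iUnion.2 ⟨i, Or.inl ⟨fun j => (hxi j).1, fun j => ?_⟩⟩⟩
      by_cases hj : j = i
      · subst hj; simpa using hc
      · simpa [update_of_ne hj] using (hxi j).2.le
    · by_contra hc
      refine hxS ⟨hx, Set.mem_iUnion.2 ⟨i, Or.inr ⟨fun j => ?_, fun j => (hxi j).2.le⟩⟩⟩
      by_cases hj : j = i
      · subst hj; simpa using hc
      · simpa [update_of_ne hj] using (hxi j).1
  rw [setIntegral_eq_of_subset_of_forall_sdiff_eq_zero (μ := volume) (measurableSet_box a b)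
    Set.inter_subset_left hout]
  have hlt : volume (box a b ∩ S) < ⊤ := (measure_mono Set.inter_subset_right).trans_lt hSfin
  refine (norm_setIntegral_le_of_norm_le_const (f := G) (C := M) hlt fun x hx => hG x hx.1).trans ?_
  refine mul_le_mul_of_nonneg_left ?_ hM
  calc volume.real (box a b ∩ S) ≤ volume.real S :=
        measureReal_mono Set.inter_subset_right hSfin.ne
    _ ≤ ∑ i, volume.real (S₁ i ∪ S₂ i) := measureReal_iUnion_fintype_le _
    _ ≤ ∑ i, (volume.real (S₁ i) + volume.real (S₂ i)) :=
        Finset.sum_le_sum fun i _ => measureReal_union_le _ _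
    _ = _ := by
        rw [Finset.sum_mul]
        refine Finset.sum_congr rfl fun i _ => ?_
        rw [hS₁, hS₂]
        ring

lemma Continuous.integrableOn_box {n : ℕ} {F : (Fin n → ℝ) → ℝ}
    (hF : Continuous F) (a b : Fin n → ℝ) : IntegrableOn F (box a b) := by
  have : IntegrableOn F (Set.Icc a b) := hF.continuousOn.integrableOn_compact isCompact_Icc
  refine this.mono_set ?_
  rw [← Set.pi_univ_Icc]
  exact Set.pi_mono fun i _ => Set.Ico_subset_Icc_self

lemma integrableOn_box_mul_continuous {n : ℕ} (a b : Fin n → ℝ) {h F : (Fin n → ℝ) → ℝ}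
    (hm : Measurable h) {C : ℝ} (hC : ∀ x, |h x| ≤ C) (hF : Continuous F) :
    IntegrableOn (fun x => h x * F x) (box a b) :=
  (hF.integrableOn_box a b).bdd_mul hm.aestronglyMeasurable (Filter.Eventually.of_forall hC)

/-- A charge distribution whose potential has vanishing Cauchy data is orthogonal to harmonic
exponentials. -/
lemma setIntegral_mul_harmonic_exp_eq_zero {n : ℕ} {a b : Fin n → ℝ} (hab : ∀ i, a i < b i)
    {v h : (Fin n → ℝ) → ℝ} (hv : ContDiffOn ℝ 1 v (Set.Icc a b))
    (h0 : ∀ x ∈ Set.Icc a b, ∀ i, (x i = a i ∨ x i = b i) → v x = 0)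
    (h1 : ∀ i, ∀ x ∈ Set.Icc a b, (∀ j, j ≠ i → x j ∈ Set.Ioo (a j) (b j)) →
      (x i = a i ∨ x i = b i) → fderivWithin ℝ v (Set.Icc a b) x (Pi.single i 1) = 0)
    (hm : Measurable h) {C : ℝ} (hC : ∀ x, |h x| ≤ C)
    (hdist : ∀ φ : (Fin n → ℝ) → ℝ, ContDiff ℝ (⊤ : ℕ∞) φ → HasCompactSupport φ →
      tsupport φ ⊆ interior (box a b) →
      ∫ x in box a b, v x * lap φ x = ∫ x in box a b, h x * φ x)
    {ζ : Fin n → ℂ} (hζ : ∑ i, ζ i ^ 2 = 0) (ℓ : ℂ →L[ℝ] ℝ) :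
    ∫ x in box a b, h x * ℓ (∏ j, Complex.exp (ζ j * x j)) = 0 := by
  choose Kt hKt1 hKt using fun i => exists_truncated_exp (a i) (b i) (ζ i)
  obtain ⟨L, hL, hlayer⟩ := exists_layer_integral_bound hab
  set K : ℝ := 1 + ∑ i, Kt i
  have hKK : ∀ i, Kt i ≤ K := fun i => by
    have := Finset.single_le_sum (f := Kt) (fun j _ => zero_le_one.trans (hKt1 j))
      (Finset.mem_univ i)
    simp only [K]; linarith
  have hK1 : 1 ≤ K := by
    have : 0 ≤ ∑ i, Kt i := Finset.sum_nonneg fun j _ => zero_le_one.trans (hKt1 j)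
    simp only [K]; linarith
  have hK0 : 0 < K := by linarith
  have hC0 : 0 ≤ C := (abs_nonneg _).trans (hC 0)
  have hprod : ∀ (s : Finset (Fin n)) (z : Fin n → ℂ), (∀ j, ‖z j‖ ≤ K) →
      ‖∏ j ∈ s, z j‖ ≤ K ^ n := by
    intro s z hz
    rw [norm_prod]
    calc ∏ j ∈ s, ‖z j‖ ≤ ∏ j ∈ s, K :=
          Finset.prod_le_prod (fun j _ => norm_nonneg _) fun j _ => hz j
      _ = K ^ s.card := by simp
      _ ≤ K ^ n := pow_le_pow_right₀ hK1 (by simpa using Finset.card_le_univ s)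
  set A : ℝ := C * (‖ℓ‖ * (2 * K ^ n)) * L + n * (2 * (‖ℓ‖ * (K * K ^ n))) * L
  have hA : 0 ≤ A := by positivity
  set E : (Fin n → ℝ) → ℝ := fun x => ℓ (∏ j, Complex.exp (ζ j * x j))
  have hE : Continuous E := by
    refine ℓ.continuous.comp (continuous_finsetProd _ fun j _ => ?_)
    fun_prop
  suffices H : ∀ η > 0, |∫ x in box a b, h x * E x| ≤ A * η by
    by_contra hne
    have hpos : 0 < |∫ x in box a b, h x * E x| := abs_pos.2 hne
    set I := |∫ x in box a b, h x * E x|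
    have := H (I / (2 * (A + 1))) (by positivity)
    have h2 : A * (I / (2 * (A + 1))) < I := by
      rw [← mul_div_assoc, div_lt_iff₀ (by positivity)]
      nlinarith
    linarith
  intro η hη
  obtain ⟨δ, hδ, hflat⟩ := exists_abs_le_of_flat_boundary hab hv h0 h1 hη
  set ε : ℝ := min (δ / 2) (min η 1)
  have hε : 0 < ε := lt_min (by positivity) (lt_min hη one_pos)
  have hεδ : 2 * ε ≤ δ := by
    have : ε ≤ δ / 2 := min_le_left _ _
    linarith
  have hεη : ε ≤ η := (min_le_right _ _).trans (min_le_left _ _)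
  have hε1 : ε ≤ 1 := (min_le_right _ _).trans (min_le_right _ _)
  choose ψ hψs hψ0 hψe hψR0 hψRe hψb using fun i => hKt i ε hε hε1
  set φ : (Fin n → ℝ) → ℝ := fun x => ℓ (∏ j, ψ j (x j))
  have hφs : ContDiff ℝ (⊤ : ℕ∞) φ :=
    ℓ.contDiff.comp (contDiff_prod fun j _ => (hψs j).comp (contDiff_apply ℝ ℝ j))
  have hsupp : Function.support φ ⊆ Set.Icc (fun i => a i + ε) (fun i => b i - ε) := by
    intro x hx
    rw [← Set.pi_univ_Icc]
    intro j _
    by_contra hj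
    refine hx ?_
    simp only [φ]
    rw [Finset.prod_eq_zero (Finset.mem_univ j) (hψ0 j _ hj), map_zero]
  have hφc : HasCompactSupport φ := HasCompactSupport.of_support_subset_isCompact isCompact_Icc hsupp
  have hφt : tsupport φ ⊆ interior (box a b) := by
    refine (closure_minimal hsupp isClosed_Icc).trans ?_
    rw [interior_box, ← Set.pi_univ_Icc]
    refine Set.pi_mono fun i _ s hs => ⟨?_, ?_⟩
    · linarith [hs.1]
    · linarith [hs.2]
  have hbox : ∀ x ∈ box a b, ∀ j, x j ∈ Set.Icc (a j) (b j) := fun x hx j =>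
    Set.Ico_subset_Icc_self (hx j (Set.mem_univ j))
  have part1 : |∫ x in box a b, h x * (E x - φ x)| ≤ C * (‖ℓ‖ * (2 * K ^ n)) * (L * ε) := by
    refine hlayer ε hε _ _ (by positivity) (fun x hx => ?_) (fun x hx hin => ?_)
    · rw [abs_mul]
      refine mul_le_mul (hC x) ?_ (abs_nonneg _) hC0
      simp only [E, φ]
      rw [← map_sub, ← Real.norm_eq_abs]
      refine (ℓ.le_opNorm _).trans (mul_le_mul_of_nonneg_left ?_ (norm_nonneg _))
      refine (norm_sub_le _ _).trans ?_
      rw [two_mul]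
      exact add_le_add
        (hprod _ _ fun j => (hψb j _ (hbox x hx j)).1.trans (hKK j))
        (hprod _ _ fun j => (hψb j _ (hbox x hx j)).2.1.trans (hKK j))
    · have : E x = φ x := by
        simp only [E, φ]
        congr 1
        exact Finset.prod_congr rfl fun j _ => (hψe j _ (Set.Ioo_subset_Icc_self (hin j))).symm
      rw [this, sub_self, mul_zero]
  have hlap : ∀ x, lap φ x = ∑ i, ℓ ((deriv (deriv (ψ i)) (x i) - ζ i ^ 2 * ψ i (x i))
      * ∏ j ∈ Finset.univ.erase i, ψ j (x j)) := by
    intro x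
    rw [lap_clm_prod ℓ hψs x]
    have : ∑ i, ℓ (ζ i ^ 2 * ψ i (x i) * ∏ j ∈ Finset.univ.erase i, ψ j (x j)) = 0 := by
      rw [← map_sum]
      simp only [mul_assoc, Finset.mul_prod_erase Finset.univ (fun j => ψ j (x j))
        (Finset.mem_univ _)]
      rw [← Finset.sum_mul, hζ, zero_mul, map_zero]
    simp only [sub_mul, map_sub, Finset.sum_sub_distrib, this, sub_zero]
  have part2 : |∫ x in box a b, v x * lap φ x|
      ≤ n * (2 * ε * η * (‖ℓ‖ * (K / ε ^ 2 * K ^ n))) * (L * ε) := by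
    refine hlayer ε hε _ _ (by positivity) (fun x hx => ?_) (fun x hx hin => ?_)
    · rw [hlap, Finset.mul_sum]
      refine (Finset.abs_sum_le_sum_abs _ _).trans ?_
      refine (Finset.sum_le_card_nsmul _ _ (2 * ε * η * (‖ℓ‖ * (K / ε ^ 2 * K ^ n)))
        fun i _ => ?_).trans (by simp)
      have hnn : 0 ≤ 2 * ε * η * (‖ℓ‖ * (K / ε ^ 2 * K ^ n)) := by positivity
      by_cases hxin : ∀ j, x j ∈ Set.Icc (a j + ε) (b j - ε)
      · by_cases hxi : x i ∈ Set.Ioo (a i + 2 * ε) (b i - 2 * ε)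
        · rw [hψRe i _ hxi, zero_mul, map_zero, mul_zero, abs_zero]
          exact hnn
        · have hxI : ∀ j, x j ∈ Set.Ioo (a j) (b j) := fun j =>
            ⟨by linarith [(hxin j).1], by linarith [(hxin j).2]⟩
          have hvx : |v x| ≤ 2 * ε * η := by
            have : ∃ c, (c = a i ∨ c = b i) ∧ |x i - c| ≤ 2 * ε := by
              by_cases hl : a i + 2 * ε < x i
              · have hr : b i - 2 * ε ≤ x i := by
                  by_contra hr
                  exact hxi ⟨hl, not_le.1 hr⟩
                exact ⟨b i, Or.inr rfl, abs_le.2 ⟨by linarith, by linarith [(hxI i).2]⟩⟩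
              · exact ⟨a i, Or.inl rfl, abs_le.2 ⟨by linarith [(hxI i).1], by linarith⟩⟩
            obtain ⟨c, hc, hxc⟩ := this
            refine (hflat x hxI i c hc (hxc.trans hεδ)).trans ?_
            rw [mul_comm]
            exact mul_le_mul_of_nonneg_right hxc hη.le
          rw [abs_mul]
          refine mul_le_mul hvx ?_ (abs_nonneg _) (by positivity)
          rw [← Real.norm_eq_abs]
          refine (ℓ.le_opNorm _).trans (mul_le_mul_of_nonneg_left ?_ (norm_nonneg _))
          rw [norm_mul]
          refine mul_le_mul ?_ ?_ (norm_nonneg _) (by positivity)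
          · refine ((hψb i _ (hbox x hx i)).2.2).trans ?_
            gcongr
            exact hKK i
          · exact hprod _ _ fun j => (hψb j _ (hbox x hx j)).2.1.trans (hKK j)
      · push Not at hxin
        obtain ⟨j, hj⟩ := hxin
        have : (deriv (deriv (ψ i)) (x i) - ζ i ^ 2 * ψ i (x i))
            * ∏ j ∈ Finset.univ.erase i, ψ j (x j) = 0 := by
          by_cases hij : j = i
          · subst hij
            rw [hψR0 j _ hj, zero_mul]
          · rw [Finset.prod_eq_zero (Finset.mem_erase.2 ⟨hij, Finset.mem_univ j⟩) (hψ0 j _ hj),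
              mul_zero]
        rw [this, map_zero, mul_zero, abs_zero]
        exact hnn
    · rw [hlap, Finset.sum_eq_zero, mul_zero]
      intro i _
      rw [hψRe i _ (hin i), zero_mul, map_zero]
  have hEφ : Continuous fun x => E x - φ x := hE.sub hφs.continuous
  have hsplit : ∫ x in box a b, h x * E x
      = (∫ x in box a b, h x * (E x - φ x)) + ∫ x in box a b, h x * φ x := by
    rw [← integral_add (integrableOn_box_mul_continuous a b hm hC hEφ)
      (integrableOn_box_mul_continuous a b hm hC hφs.continuous)]
    congr 1
    ext x
    ring
  rw [hsplit, ← hdist φ hφs hφc hφt]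
  refine (abs_add_le _ _).trans ((add_le_add part1 part2).trans ?_)
  have e2 : n * (2 * ε * η * (‖ℓ‖ * (K / ε ^ 2 * K ^ n))) * (L * ε)
      = n * (2 * (‖ℓ‖ * (K * K ^ n))) * L * η := by
    field_simp
  have e1 : C * (‖ℓ‖ * (2 * K ^ n)) * (L * ε) ≤ C * (‖ℓ‖ * (2 * K ^ n)) * (L * η) := by
    gcongr
  rw [e2]
  refine (add_le_add_left e1 _).trans (le_of_eq ?_)
  simp only [A]
  ring

lemma mul_integral_Ico_exp (ζ : ℂ) {lo hi : ℝ} (h : lo < hi) :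
    ζ * ∫ s in Set.Ico lo hi, Complex.exp (ζ * s)
      = Complex.exp (ζ * hi) - Complex.exp (ζ * lo) := by
  by_cases hζ : ζ = 0
  · simp [hζ]
  · rw [integral_Ico_eq_integral_Ioo, ← integral_Ioc_eq_integral_Ioo,
      ← intervalIntegral.integral_of_le h.le, integral_exp_mul_complex hζ, mul_div_cancel₀ _ hζ]

/-- The Fourier–Laplace transform of the characteristic function of a box. -/
lemma prod_mul_setIntegral_box_exp {n : ℕ} (ζ : Fin n → ℂ) {lo hi : Fin n → ℝ}
    (h : ∀ i, lo i < hi i) :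
    (∏ i, ζ i) * ∫ x in box lo hi, ∏ i, Complex.exp (ζ i * x i)
      = ∏ i, (Complex.exp (ζ i * hi i) - Complex.exp (ζ i * lo i)) := by
  rw [box, volume_pi, Measure.restrict_pi_pi,
    integral_fintype_prod_eq_prod (fun i (s : ℝ) => Complex.exp (ζ i * s)),
    ← Finset.prod_mul_distrib]
  exact Finset.prod_congr rfl fun i _ => mul_integral_Ico_exp _ (h i)

/-- The character `t ↦ exp (t z)` of the additive group of the reals. -/
def expChar (z : ℂ) : Multiplicative ℝ →* ℂ where
  toFun t := Complex.exp ((Multiplicative.toAdd t : ℝ) * z)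
  map_one' := by simp
  map_mul' s t := by simp [add_mul, Complex.exp_add]

lemma expChar_injective : Injective expChar := by
  intro z w hzw
  have hd : ∀ z : ℂ, HasDerivAt (fun t : ℝ => Complex.exp (t * z)) z 0 := fun z => by
    have := (((hasDerivAt_id (0:ℝ)).ofReal_comp).mul_const z).cexp
    simpa using this
  have heq : (fun t : ℝ => Complex.exp (t * z)) = fun t : ℝ => Complex.exp (t * w) :=
    funext fun t => DFunLike.congr_fun hzw (Multiplicative.ofAdd t)
  have h2 := hd z
  rw [heq] at h2
  exact h2.unique (hd w)

lemma sum_mul_eq_zero_of_sum_exp_eq_zero {J X : Type*} [Fintype J] (m : J → ℂ) (V : J → X)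
    (L : X → ℂ) (hL : ∀ j k, L (V j) = L (V k) → V j = V k)
    (h : ∀ t : ℝ, ∑ j, m j * Complex.exp (t * L (V j)) = 0) (Φ : X → ℂ) :
    ∑ j, m j * Φ (V j) = 0 := by
  classical
  have hli : LinearIndependent ℂ fun z : ℂ => (expChar z : Multiplicative ℝ → ℂ) :=
    (linearIndependent_monoidHom (Multiplicative ℝ) ℂ).comp expChar expChar_injective
  set S : Finset ℂ := Finset.univ.image fun j => L (V j)
  have hS : ∀ j ∈ (Finset.univ : Finset J), L (V j) ∈ S := fun j hj =>
    Finset.mem_image_of_mem (fun j => L (V j)) hj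
  have hg : ∀ z ∈ S, ∑ j with L (V j) = z, m j = 0 := by
    refine linearIndependent_iff'.1 hli S (fun z => ∑ j with L (V j) = z, m j) ?_
    ext t
    simp only [Finset.sum_apply, Pi.smul_apply, smul_eq_mul, Pi.zero_apply]
    rw [← h (Multiplicative.toAdd t), ← Finset.sum_fiberwise_of_maps_to hS]
    refine Finset.sum_congr rfl fun z _ => ?_
    rw [Finset.sum_mul]
    refine Finset.sum_congr rfl fun j hj => ?_
    rw [(Finset.mem_filter.1 hj).2]
    rfl
  rw [← Finset.sum_fiberwise_of_maps_to hS]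
  refine Finset.sum_eq_zero fun z hz => ?_
  obtain ⟨j₀, -, hj₀⟩ := Finset.mem_image.1 hz
  rw [Finset.sum_congr rfl (g := fun j => m j * Φ (V j₀)), ← Finset.sum_mul, hg z hz, zero_mul]
  intro j hj
  rw [hL j j₀ ((Finset.mem_filter.1 hj).2.trans hj₀.symm)]

/-- In dimension at least two, isotropic complex vectors separate real vectors. -/
lemma exists_isotropic_separating {n : ℕ} (hn : 2 ≤ n) (D : Finset (Fin n → ℝ)) :
    ∃ ζ : Fin n → ℂ, ∑ i, ζ i ^ 2 = 0 ∧ ∀ d ∈ D, ∑ i, ζ i * d i = 0 → d = 0 := by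
  classical
  set P : (Fin n → ℝ) → Polynomial ℝ := fun d =>
    ∑ i : Fin n, Polynomial.C (d i) * Polynomial.X ^ (i : ℕ)
  have hP : ∀ d, P d = 0 → d = 0 := by
    intro d hd
    ext i
    have := congrArg (fun p => Polynomial.coeff p (i : ℕ)) hd
    simpa [P, Polynomial.finsetSum_coeff, Polynomial.coeff_X_pow, Fin.val_inj] using this
  obtain ⟨τ, hτ, hτD⟩ := (Set.Ioi_infinite (0:ℝ)).exists_notMem_finset
    (D.biUnion fun d => (P d).roots.toFinset)
  have hτ0 : 0 < τ := hτ
  set o : Fin n := ⟨0, by lia⟩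
  set S : ℝ := ∑ i ∈ Finset.univ.erase o, (τ ^ (i : ℕ)) ^ 2
  have hS : 0 < S := by
    refine Finset.sum_pos (fun i _ => by positivity) ⟨⟨1, by lia⟩, ?_⟩
    simp [o]
  have hSs : (Real.sqrt S : ℂ) ^ 2 = S := by
    exact_mod_cast Real.sq_sqrt hS.le
  set ζ : Fin n → ℂ := fun i => if i = o then Complex.I * Real.sqrt S else ((τ ^ (i : ℕ) : ℝ) : ℂ)
  have hζo : ζ o = Complex.I * Real.sqrt S := by simp [ζ]
  have hζ : ∀ i ∈ Finset.univ.erase o, ζ i = ((τ ^ (i : ℕ) : ℝ) : ℂ) := fun i hi => by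
    simp only [ζ, if_neg (Finset.ne_of_mem_erase hi)]
  refine ⟨ζ, ?_, fun d hd hsum => ?_⟩
  · rw [← Finset.add_sum_erase _ _ (Finset.mem_univ o), hζo, mul_pow, hSs, Complex.I_sq,
      Finset.sum_congr rfl fun i hi => by rw [hζ i hi]]
    simp only [S]
    push_cast
    ring
  · rw [← Finset.add_sum_erase _ _ (Finset.mem_univ o), hζo,
      Finset.sum_congr rfl fun i hi => by rw [hζ i hi]] at hsum
    have him : Real.sqrt S * d o = 0 := by
      have := congrArg Complex.im hsum
      simpa [← Complex.ofReal_mul, ← Complex.ofReal_pow, mul_assoc] using this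
    have hre : ∑ i ∈ Finset.univ.erase o, τ ^ (i : ℕ) * d i = 0 := by
      have := congrArg Complex.re hsum
      simpa [← Complex.ofReal_mul, ← Complex.ofReal_pow, mul_assoc] using this
    have hdo : d o = 0 := (mul_eq_zero.1 him).resolve_left (Real.sqrt_pos.2 hS).ne'
    have heval : (P d).eval τ = 0 := by
      have : (P d).eval τ = ∑ i : Fin n, τ ^ (i : ℕ) * d i := by
        simp only [P, Polynomial.eval_finsetSum, Polynomial.eval_mul, Polynomial.eval_C,
          Polynomial.eval_pow, Polynomial.eval_X]
        exact Finset.sum_congr rfl fun i _ => mul_comm _ _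
      rw [this, ← Finset.add_sum_erase _ _ (Finset.mem_univ o), hdo, mul_zero, zero_add, hre]
    by_contra hd0
    refine hτD (Finset.mem_biUnion.2 ⟨d, hd, ?_⟩)
    rw [Multiset.mem_toFinset, Polynomial.mem_roots fun h => hd0 (hP d h)]
    exact heval

/-- A checkered function is determined by its Fourier–Laplace transform on the isotropic cone. -/
lemma checkered_sum_eq_zero {n : ℕ} (hn : 2 ≤ n) {ι : Type*} [Fintype ι] (c : ι → ℝ)
    (lo hi : ι → Fin n → ℝ) (hlt : ∀ k i, lo k i < hi k i)
    (hc : ∀ ζ : Fin n → ℂ, ∑ i, ζ i ^ 2 = 0 →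
      ∑ k, (c k : ℂ) * ∫ x in box (lo k) (hi k), ∏ i, Complex.exp (ζ i * x i) = 0)
    (x : Fin n → ℝ) :
    ∑ k, c k * Set.indicator (box (lo k) (hi k)) (fun _ => (1:ℝ)) x = 0 := by
  classical
  set V : ι × (Fin n → Bool) → Fin n → ℝ := fun p i => if p.2 i then hi p.1 i else lo p.1 i
  set m : ι × (Fin n → Bool) → ℂ := fun p => c p.1 * ∏ i, if p.2 i then 1 else -1
  have expand : ∀ F : Fin n → ℝ → ℂ, ∑ p, m p * ∏ i, F i (V p i)
      = ∑ k, (c k : ℂ) * ∏ i, (F i (hi k i) - F i (lo k i)) := by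
    intro F
    rw [Fintype.sum_prod_type]
    refine Finset.sum_congr rfl fun k _ => ?_
    have : ∀ i, F i (hi k i) - F i (lo k i)
        = ∑ β : Bool, (if β then (1:ℂ) else -1) * F i (if β then hi k i else lo k i) := by
      intro i
      simp [sub_eq_add_neg]
    simp only [this]
    rw [Fintype.prod_sum, Finset.mul_sum]
    refine Finset.sum_congr rfl fun σ _ => ?_
    simp only [m, V, Finset.prod_mul_distrib, mul_assoc]
  obtain ⟨ζ, hζ, hsep⟩ := exists_isotropic_separating hn
    ((Finset.univ : Finset ((ι × (Fin n → Bool)) × (ι × (Fin n → Bool)))).image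
      fun p => V p.1 - V p.2)
  have hvan := sum_mul_eq_zero_of_sum_exp_eq_zero m V (fun y => ∑ i, ζ i * y i) ?_ ?_
    (fun y => ∏ i, if x i < y i then 1 else 0)
  · rw [expand fun i s => if x i < s then 1 else 0] at hvan
    have hind : ∀ k, ∏ i, ((if x i < hi k i then (1:ℂ) else 0) - if x i < lo k i then 1 else 0)
        = (Set.indicator (box (lo k) (hi k)) (fun _ => (1:ℝ)) x : ℝ) := by
      intro k
      by_cases hx : x ∈ box (lo k) (hi k)
      · rw [Set.indicator_of_mem hx, Complex.ofReal_one]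
        refine Finset.prod_eq_one fun i _ => ?_
        have := hx i (Set.mem_univ i)
        rw [if_pos this.2, if_neg (not_lt.2 this.1), sub_zero]
      · rw [Set.indicator_of_notMem hx, Complex.ofReal_zero]
        have : ∃ i, ¬ (lo k i ≤ x i ∧ x i < hi k i) := by
          by_contra hall
          push Not at hall
          exact hx fun i _ => hall i
        obtain ⟨i, hxi⟩ := this
        refine Finset.prod_eq_zero (Finset.mem_univ i) ?_
        by_cases h1 : x i < lo k i
        · rw [if_pos h1, if_pos (h1.trans (hlt k i)), sub_self]
        · rw [if_neg h1, if_neg fun h2 => hxi ⟨not_lt.1 h1, h2⟩, sub_zero]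
    simp only [hind] at hvan
    exact_mod_cast hvan
  · intro p q hpq
    refine sub_eq_zero.1 (hsep _ (Finset.mem_image_of_mem _ (Finset.mem_univ (p, q))) ?_)
    simp only [Pi.sub_apply, Complex.ofReal_sub, mul_sub, Finset.sum_sub_distrib]
    exact sub_eq_zero.2 hpq
  · intro t
    have hexp : ∀ y : Fin n → ℝ, Complex.exp (t * ∑ i, ζ i * y i)
        = ∏ i, Complex.exp (t * ζ i * y i) := by
      intro y
      rw [← Complex.exp_sum, Finset.mul_sum]
      simp only [mul_assoc]
    simp only [hexp]
    rw [expand fun i s => Complex.exp (t * ζ i * s)]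
    simp only [← prod_mul_setIntegral_box_exp (fun i => t * ζ i) (hlt _)]
    have hscale : ∑ i, ((t : ℂ) * ζ i) ^ 2 = 0 := by
      simp only [mul_pow]
      rw [← Finset.mul_sum, hζ, mul_zero]
    calc _ = (∏ i, (t * ζ i)) * ∑ k, (c k : ℂ) *
          ∫ x in box (lo k) (hi k), ∏ i, Complex.exp (t * ζ i * x i) := by
          rw [Finset.mul_sum]
          exact Finset.sum_congr rfl fun k _ => by ring
      _ = 0 := by rw [hc (fun i => t * ζ i) hscale, mul_zero]

lemma Checkered.measurable {n : ℕ} {P : Set (Fin n → ℝ)} {f : (Fin n → ℝ) → ℝ}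
    (hf : Checkered P f) : Measurable f := by
  obtain ⟨N, c, lo, hi, -, -, rfl⟩ := hf
  exact Finset.measurable_sum _ fun k _ =>
    (measurable_const.indicator (measurableSet_box _ _)).const_mul _

lemma Checkered.exists_bound {n : ℕ} {P : Set (Fin n → ℝ)} {f : (Fin n → ℝ) → ℝ}
    (hf : Checkered P f) : ∃ C, ∀ x, |f x| ≤ C := by
  obtain ⟨N, c, lo, hi, -, -, rfl⟩ := hf
  refine ⟨∑ k, |c k|, fun x => (Finset.abs_sum_le_sum_abs _ _).trans
    (Finset.sum_le_sum fun k _ => ?_)⟩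
  rw [abs_mul]
  refine mul_le_of_le_one_right (abs_nonneg _) ?_
  by_cases hx : x ∈ box (lo k) (hi k) <;> simp [hx]

lemma Checkered.sub {n : ℕ} {P : Set (Fin n → ℝ)} {f g : (Fin n → ℝ) → ℝ}
    (hf : Checkered P f) (hg : Checkered P g) : Checkered P fun x => f x - g x := by
  obtain ⟨N, c, lo, hi, h1, h2, rfl⟩ := hf
  obtain ⟨M, c', lo', hi', h1', h2', rfl⟩ := hg
  refine ⟨N + M, Fin.append c (-c'), Fin.append lo lo', Fin.append hi hi', fun k => ?_,
    fun k => ?_, ?_⟩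
  · refine Fin.addCases (fun k => ?_) (fun k => ?_) k
    · simpa using h1 k
    · simpa using h1' k
  · refine Fin.addCases (fun k => ?_) (fun k => ?_) k
    · simpa using h2 k
    · simpa using h2' k
  · ext x
    simp [Fin.sum_univ_add, sub_eq_add_neg]

/-- A checkered function orthogonal to all harmonic exponentials vanishes. -/
lemma Checkered.eq_zero_of_orthogonal {n : ℕ} (hn : 2 ≤ n) {a b : Fin n → ℝ}
    {h : (Fin n → ℝ) → ℝ} (hh : Checkered (box a b) h)
    (horth : ∀ ζ : Fin n → ℂ, ∑ i, ζ i ^ 2 = 0 → ∀ ℓ : ℂ →L[ℝ] ℝ,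
      ∫ x in box a b, h x * ℓ (∏ j, Complex.exp (ζ j * x j)) = 0) (x : Fin n → ℝ) :
    h x = 0 := by
  obtain ⟨N, c, lo, hi, hlt, hsub, rfl⟩ := hh
  refine checkered_sum_eq_zero hn c lo hi hlt (fun ζ hζ => ?_) x
  set E : (Fin n → ℝ) → ℂ := fun x => ∏ j, Complex.exp (ζ j * x j)
  have hE : Continuous E := continuous_finsetProd _ fun j _ => by fun_prop
  have hEint : ∀ k, IntegrableOn E (box (lo k) (hi k)) := by
    intro k
    have : IntegrableOn E (Set.Icc (lo k) (hi k)) :=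
      hE.continuousOn.integrableOn_compact isCompact_Icc
    refine this.mono_set ?_
    rw [← closure_box (hlt k)]
    exact subset_closure
  have key : ∀ ℓ : ℂ →L[ℝ] ℝ, ℓ (∑ k, (c k : ℂ) * ∫ x in box (lo k) (hi k), E x) = 0 := by
    intro ℓ
    rw [← horth ζ hζ ℓ, map_sum]
    simp only [Finset.sum_mul]
    rw [integral_finsetSum]
    · refine Finset.sum_congr rfl fun k _ => ?_
      rw [← Complex.real_smul, map_smul, ← ℓ.integral_comp_comm (hEint k), smul_eq_mul,
        ← integral_const_mul]
      have : ∀ x, c k * Set.indicator (box (lo k) (hi k)) (fun _ => (1:ℝ)) x * ℓ (E x)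
          = Set.indicator (box (lo k) (hi k)) (fun x => c k * ℓ (E x)) x := by
        intro x
        by_cases hx : x ∈ box (lo k) (hi k) <;> simp [hx]
      rw [integral_congr_ae (Filter.Eventually.of_forall this),
        setIntegral_indicator (measurableSet_box _ _), Set.inter_eq_self_of_subset_right (hsub k)]
    · intro k _
      refine integrableOn_box_mul_continuous a b (C := |c k|)
        ((measurable_const.indicator (measurableSet_box _ _)).const_mul _) (fun x => ?_)
        (ℓ.continuous.comp hE)
      by_cases hx : x ∈ box (lo k) (hi k) <;> simp [hx]
  exact Complex.ext (key Complex.reCLM) (key Complex.imCLM)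

lemma continuous_lap {n : ℕ} {φ : (Fin n → ℝ) → ℝ} (hφ : ContDiff ℝ (⊤ : ℕ∞) φ) :
    Continuous (lap φ) := by
  refine continuous_finsetSum _ fun i _ => ?_
  have h1 : ContDiff ℝ (⊤ : ℕ∞) fun y => fderiv ℝ φ y (Pi.single i 1) :=
    (hφ.fderiv_right (m := (⊤ : ℕ∞)) (by simp)).clm_apply contDiff_const
  exact ((h1.fderiv_right (m := (⊤ : ℕ∞)) (by simp)).clm_apply contDiff_const).continuous

lemma ContDiffOn.integrableOn_box_mul {n : ℕ} {a b : Fin n → ℝ} {u F : (Fin n → ℝ) → ℝ}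
    (hab : ∀ i, a i < b i) (hu : ContDiffOn ℝ 1 u (Set.Icc a b)) (hF : Continuous F) :
    IntegrableOn (fun x => u x * F x) (box a b) := by
  have : IntegrableOn (fun x => u x * F x) (Set.Icc a b) :=
    (hu.continuousOn.mul hF.continuousOn).integrableOn_compact isCompact_Icc
  refine this.mono_set ?_
  rw [← closure_box hab]
  exact subset_closure

/-- Uniqueness for the inverse electrostatics problem with checkered charge
distributions on a box. -/
theorem inverse_electrostatics_uniqueness_checkered
    {n : ℕ} (hn : 2 ≤ n) (a b : Fin n → ℝ) (hab : ∀ i, a i < b i)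
    (f g u w : (Fin n → ℝ) → ℝ)
    (hf : Checkered (box a b) f) (hg : Checkered (box a b) g)
    (hu : ContDiffOn ℝ 1 u (closure (box a b)))
    (hw : ContDiffOn ℝ 1 w (closure (box a b)))
    -- `Δu = f` in the distributional sense on the interior of the box
    (hudist : ∀ φ : (Fin n → ℝ) → ℝ, ContDiff ℝ (⊤ : ℕ∞) φ → HasCompactSupport φ →
      tsupport φ ⊆ interior (box a b) →
      ∫ x in box a b, u x * lap φ x = ∫ x in box a b, f x * φ x)
    -- `Δw = g` in the distributional sense on the interior of the box
    (hwdist : ∀ φ : (Fin n → ℝ) → ℝ, ContDiff ℝ (⊤ : ℕ∞) φ → HasCompactSupport φ →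
      tsupport φ ⊆ interior (box a b) →
      ∫ x in box a b, w x * lap φ x = ∫ x in box a b, g x * φ x)
    -- Dirichlet data coincide on the boundary
    (hDir : ∀ x ∈ frontier (box a b), u x = w x)
    -- Neumann data coincide on the relative interior of each (n−1)-dimensional face,
    -- `ν` being the corresponding outward unit normal
    (hNeu : ∀ (i : Fin n) (x : Fin n → ℝ), x ∈ closure (box a b) →
      (∀ j, j ≠ i → x j ∈ Set.Ioo (a j) (b j)) →
      ∀ ν : Fin n → ℝ,
        ((x i = a i ∧ ν = -Pi.single i 1) ∨ (x i = b i ∧ ν = Pi.single i 1)) →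
        fderivWithin ℝ u (closure (box a b)) x ν
          = fderivWithin ℝ w (closure (box a b)) x ν) :
    f =ᵐ[volume.restrict (box a b)] g := by
  obtain ⟨C₁, hC₁⟩ := hf.exists_bound
  obtain ⟨C₂, hC₂⟩ := hg.exists_bound
  have hh := hf.sub hg
  obtain ⟨C, hC⟩ := hh.exists_bound
  rw [closure_box hab] at hu hw
  simp only [closure_box hab] at hNeu
  have hfr : ∀ x ∈ Set.Icc a b, ∀ i, (x i = a i ∨ x i = b i) → x ∈ frontier (box a b) := by
    intro x hx i hi
    rw [frontier, closure_box hab, interior_box]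
    refine ⟨hx, fun hin => ?_⟩
    have := hin i (Set.mem_univ i)
    rcases hi with hi | hi
    · exact this.1.ne' hi
    · exact this.2.ne hi
  refine Filter.Eventually.of_forall fun x => sub_eq_zero.1 ?_
  refine hh.eq_zero_of_orthogonal hn (fun ζ hζ ℓ => ?_) x
  refine setIntegral_mul_harmonic_exp_eq_zero hab (v := fun x => u x - w x) (hu.sub hw)
    (fun x hx i hi => sub_eq_zero.2 (hDir x (hfr x hx i hi))) (fun i x hx hxj hi => ?_)
    hh.measurable hC (fun φ hφ hφc hφt => ?_) hζ ℓ
  · rw [fderivWithin_fun_sub (uniqueDiffOn_Icc_pi hab x hx) (hu.differentiableOn one_ne_zero x hx)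
      (hw.differentiableOn one_ne_zero x hx), _root_.sub_apply, sub_eq_zero]
    rcases hi with hi | hi
    · simpa using hNeu i x hx hxj _ (Or.inl ⟨hi, rfl⟩)
    · exact hNeu i x hx hxj _ (Or.inr ⟨hi, rfl⟩)
  · simp only [sub_mul]
    rw [integral_sub (hu.integrableOn_box_mul hab (continuous_lap hφ))
        (hw.integrableOn_box_mul hab (continuous_lap hφ)),
      integral_sub (integrableOn_box_mul_continuous a b hf.measurable hC₁ hφ.continuous)
        (integrableOn_box_mul_continuous a b hg.measurable hC₂ hφ.continuous),
      hudist φ hφ hφc hφt, hwdist φ hφ hφc hφt]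
end
end

section
/- Let μ : ℝ³ → ℝ be a function supported on a finite set. If Σ_v μ(v)·exp(α⟨Θ,v⟩ + iα⟨Ψ,v⟩) = 0 for every real α ≠ 0 and every admissible pair (Θ,Ψ), then μ(v) = 0 for every v ∈ ℝ³. -/
open MeasureTheory Complex

noncomputable section

/-- A pair `(Θ,Ψ)` of orthogonal unit vectors in `ℝ³` is admissible if
`Θ_l + iΨ_l ≠ 0` for each `l`. -/
def Admissible (Θ Ψ : Fin 3 → ℝ) : Prop :=
  (∑ l, Θ l ^ 2 = 1) ∧ (∑ l, Ψ l ^ 2 = 1) ∧ (∑ l, Θ l * Ψ l = 0) ∧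
    ∀ l, (Θ l : ℂ) + Ψ l * Complex.I ≠ 0

/-- The multiplicative character `t ↦ exp (t z)` of the additive group `ℝ`. -/
def expCharacter (z : ℂ) : Multiplicative ℝ →* ℂ where
  toFun t := Complex.exp ((t.toAdd : ℂ) * z)
  map_one' := by simp
  map_mul' s t := by simp [add_mul, Complex.exp_add]

theorem expCharacter_injective : Function.Injective expCharacter := by
  intro z w h
  have hderiv : ∀ u : ℂ, HasDerivAt (fun t : ℝ => Complex.exp ((t : ℂ) * u)) u 0 := by
    intro u
    have h := ((Complex.ofRealCLM.hasDerivAt (x := (0 : ℝ))).mul_const u).cexp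
    simpa using h
  have hfun : (fun t : ℝ => Complex.exp ((t : ℂ) * z)) = fun t : ℝ => Complex.exp ((t : ℂ) * w) :=
    funext fun t => DFunLike.congr_fun h (Multiplicative.ofAdd t)
  exact (hfun ▸ hderiv z).unique (hderiv w)

/-- Exponentials with distinct complex frequencies are linearly independent on `ℝ \ {0}`. -/
theorem eq_zero_of_sum_mul_exp_eq_zero {ι : Type*} (s : Finset ι) (c z : ι → ℂ)
    (hz : Set.InjOn z s)
    (h : ∀ t : ℝ, t ≠ 0 → ∑ i ∈ s, c i * Complex.exp ((t : ℂ) * z i) = 0) :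
    ∀ i ∈ s, c i = 0 := by
  have hzero : (fun t : ℝ => ∑ i ∈ s, c i * Complex.exp ((t : ℂ) * z i)) = fun _ => 0 :=
    Continuous.ext_on (dense_compl_singleton (0 : ℝ)) (by fun_prop) continuous_const
      fun t ht => h t ht
  have hli := (linearIndependent_monoidHom (Multiplicative ℝ) ℂ).comp
    (fun i : s => expCharacter (z i))
    (fun i j hij => Subtype.ext (hz i.2 j.2 (expCharacter_injective hij)))
  rw [Fintype.linearIndependent_iff] at hli
  intro i hi
  refine hli (fun j => c j) ?_ ⟨i, hi⟩
  ext t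
  simpa [expCharacter, Finset.sum_apply, ← Finset.sum_attach s] using congrFun hzero t.toAdd

/-- A rational curve of null vectors in `ℂ³` leaves every real hyperplane
outside finitely many parameters. -/
theorem finite_setOf_null_curve_orthogonal (w : Fin 3 → ℝ) (hw : w ≠ 0) :
    {t : ℝ | (1 - t ^ 2) * w 0 + 2 * t * w 2 = 0 ∧ w 1 = 0}.Finite := by
  by_cases h1 : w 1 = 0
  · let p : Polynomial ℝ := (1 - Polynomial.X ^ 2) * Polynomial.C (w 0)
      + 2 * Polynomial.X * Polynomial.C (w 2)
    have heval : ∀ t, p.eval t = (1 - t ^ 2) * w 0 + 2 * t * w 2 := by simp [p]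
    have hp : p ≠ 0 := by
      intro hp
      have h0 := heval 0
      have h2 := heval 1
      simp only [hp, Polynomial.eval_zero] at h0 h2
      refine hw (funext fun l => ?_)
      fin_cases l <;> simp <;> linarith
    refine (Polynomial.finite_setOfPred_isRoot hp).subset fun t ht => ?_
    simpa [Polynomial.IsRoot, heval] using ht.1
  · simp [h1]

/-- Finitely many nonzero real vectors admit an admissible pair whose complexification
is orthogonal to none of them. -/
theorem exists_admissible_forall_ne_zero (W : Set (Fin 3 → ℝ)) (hW : W.Finite)
    (h0 : ∀ w ∈ W, w ≠ 0) :
    ∃ Θ Ψ : Fin 3 → ℝ, Admissible Θ Ψ ∧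
      ∀ w ∈ W, ¬(∑ l, Θ l * w l = 0 ∧ ∑ l, Ψ l * w l = 0) := by
  let V : Set (Fin 3 → ℝ) := W ∪ Set.range fun l => Pi.single l (1 : ℝ)
  have hV : V.Finite := hW.union (Set.finite_range _)
  have hV0 : ∀ w ∈ V, w ≠ 0 := by
    rintro w (hw | ⟨l, rfl⟩)
    · exact h0 w hw
    · simp
  obtain ⟨t, ht⟩ := (hV.biUnion fun w hw =>
    finite_setOf_null_curve_orthogonal w (hV0 w hw)).exists_notMem
  simp only [Set.mem_iUnion, Set.mem_ofPred_eq, not_exists] at ht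
  have hpos : 1 + t ^ 2 ≠ 0 := by positivity
  have key : ∀ w ∈ V, ¬(∑ l, ![(1 - t ^ 2) / (1 + t ^ 2), 0, 2 * t / (1 + t ^ 2)] l * w l = 0 ∧
      ∑ l, ![(0 : ℝ), 1, 0] l * w l = 0) := by
    rintro w hw ⟨hΘ, hΨ⟩
    refine ht w hw ⟨?_, by simpa [Fin.sum_univ_three] using hΨ⟩
    simp only [Fin.sum_univ_three, Matrix.cons_val] at hΘ
    field_simp at hΘ
    linarith
  refine ⟨_, _, ⟨?_, ?_, ?_, fun l hl => ?_⟩, fun w hw => key w (Or.inl hw)⟩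
  · simp only [Fin.sum_univ_three, Matrix.cons_val]
    field_simp
    ring
  · simp [Fin.sum_univ_three]
  · simp [Fin.sum_univ_three]
  · refine key _ (Or.inr ⟨l, rfl⟩) ?_
    have hre := congrArg Complex.re hl
    have him := congrArg Complex.im hl
    simp only [Complex.add_re, Complex.add_im, Complex.re_ofReal_mul, Complex.im_ofReal_mul,
      Complex.ofReal_re, Complex.ofReal_im, Complex.I_re, Complex.I_im, mul_zero, mul_one,
      add_zero, zero_add, Complex.zero_re, Complex.zero_im] at hre him
    simp only [Pi.single_apply, mul_ite, mul_one, mul_zero, Finset.sum_ite_eq', Finset.mem_univ,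
      if_true]
    exact ⟨hre, him⟩

/-- If a finitely supported function `μ : ℝ³ → ℝ` satisfies
`Σ_v μ(v) exp(α⟨Θ,v⟩ + iα⟨Ψ,v⟩) = 0` for every `α ≠ 0` and every admissible pair
`(Θ,Ψ)`, then `μ ≡ 0`. -/
theorem finitely_supported_eq_zero_of_exponential_sums_eq_zero
    (μ : (Fin 3 → ℝ) → ℝ) (hfin : (Function.support μ).Finite)
    (hsum : ∀ (α : ℝ), α ≠ 0 → ∀ Θ Ψ : Fin 3 → ℝ, Admissible Θ Ψ →
      ∑ᶠ v : Fin 3 → ℝ, (μ v : ℂ) *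
        Complex.exp (((α * ∑ l, Θ l * v l : ℝ) : ℂ)
          + ((α * ∑ l, Ψ l * v l : ℝ) : ℂ) * Complex.I) = 0) :
    ∀ v, μ v = 0 := by
  let W : Set (Fin 3 → ℝ) :=
    Set.image (fun p : (Fin 3 → ℝ) × (Fin 3 → ℝ) => p.1 - p.2)
      (Function.support μ ×ˢ Function.support μ) \ {0}
  obtain ⟨Θ, Ψ, hadm, hne⟩ := exists_admissible_forall_ne_zero W
    (((hfin.prod hfin).image _).sdiff) fun w hw => hw.2
  let z : (Fin 3 → ℝ) → ℂ := fun v =>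
    ((∑ l, Θ l * v l : ℝ) : ℂ) + ((∑ l, Ψ l * v l : ℝ) : ℂ) * Complex.I
  have hz : Set.InjOn z hfin.toFinset := by
    intro v hv u hu hvu
    by_contra huv
    refine hne (v - u) ⟨⟨(v, u), ⟨by simpa using hv, by simpa using hu⟩, rfl⟩,
      sub_ne_zero.2 huv⟩ ?_
    have hre := congrArg Complex.re hvu
    have him := congrArg Complex.im hvu
    simp only [z, Complex.add_re, Complex.add_im, Complex.re_ofReal_mul, Complex.im_ofReal_mul,
      Complex.ofReal_re, Complex.ofReal_im, Complex.I_re, Complex.I_im, mul_zero, mul_one,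
      add_zero, zero_add] at hre him
    simp only [Pi.sub_apply, mul_sub, Finset.sum_sub_distrib, sub_eq_zero]
    exact ⟨hre, him⟩
  have hμ := eq_zero_of_sum_mul_exp_eq_zero hfin.toFinset (fun v => (μ v : ℂ)) z hz
    fun t ht => by
      rw [← hsum t ht Θ Ψ hadm, finsum_eq_sum_of_support_subset (s := hfin.toFinset)]
      · refine Finset.sum_congr rfl fun v _ => ?_
        simp only [z, Complex.ofReal_mul, mul_add, mul_assoc]
      · intro v hv
        have hv' := left_ne_zero_of_mul hv
        simpa using hv'
  intro v
  by_contra hv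
  exact hv (by exact_mod_cast hμ v (by simpa using hv))
end
end

section
/- Let n ≥ 2 be an integer and let r₁, r₂, r₃ be real numbers with 0 < r₁ < r₂ < r₃. Then (r₃ⁿ − r₂ⁿ)·(r₂ⁿ⁺² − r₁ⁿ⁺²) − (r₃ⁿ⁺² − r₂ⁿ⁺²)·(r₂ⁿ − r₁ⁿ) ≠ 0. -/
lemma Real.pow_rpow_div {x : ℝ} (hx : 0 ≤ x) (m : ℕ) {n : ℕ} (hn : n ≠ 0) :
    (x ^ n) ^ ((m : ℝ) / n) = x ^ m := by
  rw [← Real.rpow_natCast x n, ← Real.rpow_mul hx,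
    mul_div_cancel₀ _ (Nat.cast_ne_zero.mpr hn), Real.rpow_natCast]

/-- For `n ≥ 2` and `0 < r₁ < r₂ < r₃`, the determinant
`(r₃ⁿ − r₂ⁿ)(r₂ⁿ⁺² − r₁ⁿ⁺²) − (r₃ⁿ⁺² − r₂ⁿ⁺²)(r₂ⁿ − r₁ⁿ)` does not vanish. -/
theorem determinant_ne_zero
    (n : ℕ) (hn : 2 ≤ n) (r₁ r₂ r₃ : ℝ)
    (h₁ : 0 < r₁) (h₁₂ : r₁ < r₂) (h₂₃ : r₂ < r₃) :
    (r₃ ^ n - r₂ ^ n) * (r₂ ^ (n + 2) - r₁ ^ (n + 2))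
      - (r₃ ^ (n + 2) - r₂ ^ (n + 2)) * (r₂ ^ n - r₁ ^ n) ≠ 0 := by
  have hn0 : n ≠ 0 := by omega
  have h₂ : 0 < r₂ := h₁.trans h₁₂
  have h₃ : 0 < r₃ := h₂.trans h₂₃
  have hp : 1 < ((n + 2 : ℕ) : ℝ) / n := by
    rw [one_lt_div (by positivity)]
    exact_mod_cast (by omega : n < n + 2)
  have hxy : r₁ ^ n < r₂ ^ n := pow_lt_pow_left₀ h₁₂ h₁.le hn0
  have hyz : r₂ ^ n < r₃ ^ n := pow_lt_pow_left₀ h₂₃ h₂.le hn0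
  have h := (strictConvexOn_rpow hp).slope_strict_mono_adjacent
    (Set.mem_Ici.mpr (pow_pos h₁ n).le) (Set.mem_Ici.mpr (pow_pos h₃ n).le) hxy hyz
  rw [Real.pow_rpow_div h₁.le _ hn0, Real.pow_rpow_div h₂.le _ hn0,
    Real.pow_rpow_div h₃.le _ hn0, div_lt_div_iff₀ (sub_pos.mpr hxy) (sub_pos.mpr hyz)] at h
  rw [mul_comm (r₃ ^ n - r₂ ^ n)]
  exact (sub_neg.mpr h).ne
end

section
/- Let Ω ⊆ ℝⁿ be open, let α ∈ ℝ with α ≠ −1, and let U : Ω → ℝⁿ be four times continuously differentiable with ΔU + α·grad div U = 0 on Ω. Then Δ(ΔU) = 0 on Ω, i.e. every component of U is biharmonic. -/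
noncomputable section

/-- Partial derivative `∂f/∂xᵢ`. -/
def pd {n : ℕ} (f : (Fin n → ℝ) → ℝ) (i : Fin n) (x : Fin n → ℝ) : ℝ :=
  fderiv ℝ f x (Pi.single i 1)

/-- Componentwise Laplacian of a vector field. -/
def vlap {n : ℕ} (U : (Fin n → ℝ) → Fin n → ℝ) (x : Fin n → ℝ) (i : Fin n) : ℝ :=
  ∑ j, pd (fun y => pd (fun z => U z i) j y) j x

/-- Divergence of a vector field. -/
def divg {n : ℕ} (U : (Fin n → ℝ) → Fin n → ℝ) (x : Fin n → ℝ) : ℝ :=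
  ∑ i, pd (fun z => U z i) i x

/-- `grad div` of a vector field. -/
def gradDiv {n : ℕ} (U : (Fin n → ℝ) → Fin n → ℝ) (x : Fin n → ℝ) (i : Fin n) : ℝ :=
  pd (divg U) i x

/-- The scalar Laplacian, as a sum of iterated partial derivatives. -/
def slap {n : ℕ} (f : (Fin n → ℝ) → ℝ) (x : Fin n → ℝ) : ℝ :=
  ∑ j, pd (pd f j) j x

section PartialDerivatives

variable {n : ℕ} {Ω : Set (Fin n → ℝ)} {f g : (Fin n → ℝ) → ℝ}

theorem pd_eqOn (hΩ : IsOpen Ω) (h : Set.EqOn f g Ω) (i : Fin n) :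
    Set.EqOn (pd f i) (pd g i) Ω := by
  intro x hx
  have hfg : f =ᶠ[nhds x] g := h.eventuallyEq_of_mem (hΩ.mem_nhds hx)
  simp only [pd, hfg.fderiv_eq]

theorem contDiffOn_pd (hΩ : IsOpen Ω) {k m : WithTop ℕ∞} (hf : ContDiffOn ℝ k f Ω)
    (hmk : m + 1 ≤ k) (i : Fin n) : ContDiffOn ℝ m (pd f i) Ω :=
  (hf.fderiv_of_isOpen hΩ hmk).clm_apply contDiffOn_const

theorem differentiableAt_of_contDiffOn (hΩ : IsOpen Ω) {k : WithTop ℕ∞}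
    (hf : ContDiffOn ℝ k f Ω) (hk : k ≠ 0) {x : Fin n → ℝ} (hx : x ∈ Ω) :
    DifferentiableAt ℝ f x :=
  (hf.differentiableOn hk).differentiableAt (hΩ.mem_nhds hx)

theorem pd_sum {ι : Type*} (s : Finset ι) {F : ι → (Fin n → ℝ) → ℝ} {x : Fin n → ℝ}
    (hF : ∀ a ∈ s, DifferentiableAt ℝ (F a) x) (i : Fin n) :
    pd (fun y => ∑ a ∈ s, F a y) i x = ∑ a ∈ s, pd (F a) i x := by
  simp only [pd, fderiv_fun_sum hF, sum_apply]

theorem pd_const_mul {x : Fin n → ℝ} (hf : DifferentiableAt ℝ f x) (c : ℝ) (i : Fin n) :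
    pd (fun y => c * f y) i x = c * pd f i x := by
  simp [pd, fderiv_const_mul hf]

/-- Partial derivatives of a `C²` function commute. -/
theorem pd_comm (hΩ : IsOpen Ω) (hf : ContDiffOn ℝ 2 f Ω) (i j : Fin n) :
    Set.EqOn (pd (pd f i) j) (pd (pd f j) i) Ω := by
  intro x hx
  have hfx : ContDiffAt ℝ 2 f x := hf.contDiffAt (hΩ.mem_nhds hx)
  have hd : DifferentiableAt ℝ (fderiv ℝ f) x :=
    ((hf.fderiv_of_isOpen (m := 1) hΩ (by norm_num)).differentiableOn
      (by norm_num)).differentiableAt (hΩ.mem_nhds hx)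
  have key (a b : Fin n) : pd (pd f a) b x =
      fderiv ℝ (fderiv ℝ f) x (Pi.single b 1) (Pi.single a 1) := by
    change fderiv ℝ (fun y => fderiv ℝ f y (Pi.single a 1)) x (Pi.single b 1) = _
    rw [fderiv_clm_apply hd (differentiableAt_const _)]
    simp
  rw [key, key]
  exact hfx.isSymmSndFDerivAt (by simp) _ _

theorem slap_eqOn (hΩ : IsOpen Ω) (h : Set.EqOn f g Ω) : Set.EqOn (slap f) (slap g) Ω :=
  fun _ hx => Finset.sum_congr rfl fun j _ => pd_eqOn hΩ (pd_eqOn hΩ h j) j hx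

theorem slap_sum (hΩ : IsOpen Ω) {ι : Type*} (s : Finset ι) {F : ι → (Fin n → ℝ) → ℝ}
    (hF : ∀ a ∈ s, ContDiffOn ℝ 2 (F a) Ω) :
    Set.EqOn (slap fun y => ∑ a ∈ s, F a y) (fun x => ∑ a ∈ s, slap (F a) x) Ω := by
  intro x hx
  simp only [slap]
  rw [Finset.sum_comm]
  refine Finset.sum_congr rfl fun j _ => ?_
  have h : Set.EqOn (pd (fun y => ∑ a ∈ s, F a y) j) (fun y => ∑ a ∈ s, pd (F a) j y) Ω :=
    fun y hy => pd_sum s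
      (fun a ha => differentiableAt_of_contDiffOn hΩ (hF a ha) (by norm_num) hy) j
  rw [pd_eqOn hΩ h j hx]
  exact pd_sum s (fun a ha => differentiableAt_of_contDiffOn (k := 1) hΩ
    (contDiffOn_pd hΩ (hF a ha) (by norm_num) j) (by norm_num) hx) j

theorem slap_const_mul (hΩ : IsOpen Ω) (hf : ContDiffOn ℝ 2 f Ω) (c : ℝ) :
    Set.EqOn (slap fun y => c * f y) (fun x => c * slap f x) Ω := by
  intro x hx
  simp only [slap, Finset.mul_sum]
  refine Finset.sum_congr rfl fun j _ => ?_
  have h : Set.EqOn (pd (fun y => c * f y) j) (fun y => c * pd f j y) Ω :=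
    fun y hy => pd_const_mul (differentiableAt_of_contDiffOn hΩ hf (by norm_num) hy) c j
  rw [pd_eqOn hΩ h j hx]
  exact pd_const_mul (differentiableAt_of_contDiffOn (k := 1) hΩ
    (contDiffOn_pd hΩ hf (by norm_num) j) (by norm_num) hx) c j

/-- The Laplacian commutes with partial derivatives on `C³` functions. -/
theorem slap_pd (hΩ : IsOpen Ω) (hf : ContDiffOn ℝ 3 f Ω) (i : Fin n) :
    Set.EqOn (slap (pd f i)) (pd (slap f) i) Ω := by
  intro x hx
  have hpd (j : Fin n) : ContDiffOn ℝ 2 (pd f j) Ω := contDiffOn_pd hΩ hf (by norm_num) j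
  have hpd2 (j : Fin n) : DifferentiableAt ℝ (pd (pd f j) j) x :=
    differentiableAt_of_contDiffOn (k := 1) hΩ
      (contDiffOn_pd hΩ (hpd j) (by norm_num) j) (by norm_num) hx
  refine Eq.trans ?_ (pd_sum Finset.univ (fun j _ => hpd2 j) i).symm
  refine Finset.sum_congr rfl fun j _ => ?_
  rw [pd_eqOn hΩ (pd_comm hΩ (hf.of_le (by norm_num)) i j) j hx]
  exact pd_comm hΩ (hpd j) i j hx

end PartialDerivatives

/-- Every `C⁴` solution of the homogeneous Navier equation on an open set is
(componentwise) biharmonic. -/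
theorem navier_kernel_biharmonic
    {n : ℕ} (Ω : Set (Fin n → ℝ)) (hΩ : IsOpen Ω)
    (α : ℝ) (hα : α ≠ -1)
    (U : (Fin n → ℝ) → Fin n → ℝ) (hU : ContDiffOn ℝ 4 U Ω)
    (hNav : ∀ x ∈ Ω, ∀ i, vlap U x i + α * gradDiv U x i = 0) :
    ∀ x ∈ Ω, ∀ i, (∑ j, pd (fun y => pd (fun z => vlap U z i) j y) j x) = 0 := by
  have hu (i : Fin n) : ContDiffOn ℝ 4 (fun z => U z i) Ω := contDiffOn_pi.1 hU i
  have hdu (i : Fin n) : ContDiffOn ℝ 3 (pd (fun z => U z i) i) Ω :=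
    contDiffOn_pd hΩ (hu i) (by norm_num) i
  have hD : ContDiffOn ℝ 3 (divg U) Ω := ContDiffOn.sum fun i _ => hdu i
  have hpD (i : Fin n) : ContDiffOn ℝ 2 (pd (divg U) i) Ω :=
    contDiffOn_pd hΩ hD (by norm_num) i
  have hlap (i : Fin n) :
      Set.EqOn (slap fun z => U z i) (fun y => -α * pd (divg U) i y) Ω := by
    intro y hy
    have h : slap (fun z => U z i) y + α * pd (divg U) i y = 0 := hNav y hy i
    linear_combination h
  have hharm : Set.EqOn (slap (divg U)) (fun _ => 0) Ω := by
    intro y hy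
    have h : slap (divg U) y = -α * slap (divg U) y := by
      calc slap (divg U) y = ∑ i, slap (pd (fun z => U z i) i) y :=
            slap_sum hΩ Finset.univ (fun i _ => (hdu i).of_le (by norm_num)) hy
        _ = ∑ i, -α * pd (pd (divg U) i) i y := by
            refine Finset.sum_congr rfl fun i _ => ?_
            rw [slap_pd hΩ ((hu i).of_le (by norm_num)) i hy, pd_eqOn hΩ (hlap i) i hy]
            exact pd_const_mul
              (differentiableAt_of_contDiffOn hΩ (hpD i) (by norm_num) hy) (-α) i
        _ = -α * slap (divg U) y := (Finset.mul_sum _ _ _).symm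
    have h' : (α + 1) * slap (divg U) y = 0 := by linear_combination h
    exact (mul_eq_zero.1 h').resolve_left fun h0 => hα (by linarith)
  intro x hx i
  change slap (slap fun z => U z i) x = 0
  rw [slap_eqOn hΩ (hlap i) hx, slap_const_mul hΩ (hpD i) (-α) hx]
  simp only [slap_pd hΩ hD i hx, pd_eqOn hΩ hharm i hx]
  simp [pd]
end
end
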